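/- For every w ∈ W, the set N¹(w) = {α ∈ Φ⁺ : ℓ(s_α w) = ℓ(w) − 1} is exactly the set of positive roots α such that cone({α}) is an extreme ray of the polyhedral cone cone(N(w)) spanned by the inversion set N(w). -/

import Mathlib

section RootSystemDefs

variable {S : Type*} {W : Type*} [Group W]

/-- The simple root `α_s` in the vector space `V = S → ℝ`. -/
def simpleRoot [DecidableEq S] (s : S) : S → ℝ := Pi.single s 1

/-- The symmetric bilinear form `B` on `V = S → ℝ` with `B(α_s, α_t) = -cos (π / m s t)`
(with the convention that `B(α_s, α_t) = -1` when `m s t = ∞`, which is encoded by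
`Mmat s t = 0`). -/
noncomputable def bform [Fintype S] (Mmat : CoxeterMatrix S) (v u : S → ℝ) : ℝ :=
  ∑ s : S, ∑ t : S,
    v s * u t * (if Mmat s t = 0 then -1 else -Real.cos (Real.pi / (Mmat s t : ℝ)))

/-- The conic closure of `X`: all nonnegative linear combinations of elements of `X`. -/
def coneOf {V : Type*} [AddCommMonoid V] [Module ℝ V] (X : Set V) : Set V :=
  {v | ∃ (n : ℕ) (c : Fin n → ℝ) (x : Fin n → V),
    (∀ i, 0 ≤ c i) ∧ (∀ i, x i ∈ X) ∧ v = ∑ i, c i • x i}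

variable [Fintype S] [DecidableEq S] {Mmat : CoxeterMatrix S}

/-- The root system `Φ = W(Δ)`, for the representation `ρ` of `W` on `V = S → ℝ`. -/
def rootSet (ρ : W →* ((S → ℝ) ≃ₗ[ℝ] (S → ℝ))) : Set (S → ℝ) :=
  {v | ∃ (w : W) (s : S), v = ρ w (simpleRoot s)}

/-- The positive roots `Φ⁺ = cone(Δ) ∩ Φ`. -/
def posRoots (ρ : W →* ((S → ℝ) ≃ₗ[ℝ] (S → ℝ))) : Set (S → ℝ) :=
  coneOf (Set.range (simpleRoot (S := S))) ∩ rootSet ρ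

/-- The negative roots `Φ⁻ = -Φ⁺`. -/
def negRoots (ρ : W →* ((S → ℝ) ≃ₗ[ℝ] (S → ℝ))) : Set (S → ℝ) :=
  {v | -v ∈ posRoots ρ}

/-- Dominance order: `Dominates ρ a b` means `a ≼ b`, i.e. every `w ∈ W` sending `b` to a
negative root also sends `a` to a negative root. -/
def Dominates (ρ : W →* ((S → ℝ) ≃ₗ[ℝ] (S → ℝ))) (a b : S → ℝ) : Prop :=
  ∀ w : W, ρ w b ∈ negRoots ρ → ρ w a ∈ negRoots ρ

/-- A small root: a positive root dominating no positive root other than itself. -/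
def IsSmallRoot (ρ : W →* ((S → ℝ) ≃ₗ[ℝ] (S → ℝ))) (b : S → ℝ) : Prop :=
  b ∈ posRoots ρ ∧ ∀ a ∈ posRoots ρ, Dominates ρ a b → a = b

/-- `t : W` is the reflection `s_b` in the root `b`: it acts on `V` by
`v ↦ v - 2 B(b, v) b`. -/
def IsReflIn (Mmat : CoxeterMatrix S) (ρ : W →* ((S → ℝ) ≃ₗ[ℝ] (S → ℝ)))
    (t : W) (b : S → ℝ) : Prop :=
  ∀ v : S → ℝ, ρ t v = v - (2 * bform Mmat b v) • b

/-- The (left) inversion set `N(w) = Φ⁺ ∩ w(Φ⁻)`. -/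
def invSet (ρ : W →* ((S → ℝ) ≃ₗ[ℝ] (S → ℝ))) (w : W) : Set (S → ℝ) :=
  {b | b ∈ posRoots ρ ∧ ρ w⁻¹ b ∈ negRoots ρ}

/-- `N¹(w) = {α ∈ Φ⁺ : ℓ(s_α w) = ℓ(w) - 1}`. -/
def nOne (cs : CoxeterSystem Mmat W) (ρ : W →* ((S → ℝ) ≃ₗ[ℝ] (S → ℝ)))
    (w : W) : Set (S → ℝ) :=
  {b | b ∈ posRoots ρ ∧
    ∃ t : W, IsReflIn Mmat ρ t b ∧ cs.length (t * w) + 1 = cs.length w}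

/-- A low element of `W`: an element `w` with `N¹(w) ⊆ Σ`. -/
def IsLow (cs : CoxeterSystem Mmat W) (ρ : W →* ((S → ℝ) ≃ₗ[ℝ] (S → ℝ)))
    (w : W) : Prop :=
  ∀ b ∈ nOne cs ρ w, IsSmallRoot ρ b

end RootSystemDefs

section GeometricRepresentation

variable {S : Type*} {W : Type*} [Group W]

/-! ### Conic closures -/

theorem sum_smul_mem_coneOf {V ι : Type*} [AddCommMonoid V] [Module ℝ V] [Fintype ι] {X : Set V}
    {c : ι → ℝ} {x : ι → V} (hc : ∀ i, 0 ≤ c i) (hx : ∀ i, x i ∈ X) :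
    ∑ i, c i • x i ∈ coneOf X := by
  let e := Fintype.equivFin ι
  refine ⟨Fintype.card ι, c ∘ e.symm, x ∘ e.symm, fun i => hc _, fun i => hx _, ?_⟩
  exact (e.symm.sum_comp fun i => c i • x i).symm

theorem smul_mem_coneOf {V : Type*} [AddCommMonoid V] [Module ℝ V] {X : Set V}
    {c : ℝ} {x : V} (hc : 0 ≤ c) (hx : x ∈ X) : c • x ∈ coneOf X := by
  simpa using sum_smul_mem_coneOf (ι := Unit) (fun _ => hc) (fun _ => hx)

theorem subset_coneOf {V : Type*} [AddCommMonoid V] [Module ℝ V] (X : Set V) : X ⊆ coneOf X :=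
  fun x hx => by simpa using smul_mem_coneOf zero_le_one hx

theorem mem_coneOf_singleton {V : Type*} [AddCommMonoid V] [Module ℝ V] {b v : V} :
    v ∈ coneOf {b} ↔ ∃ c : ℝ, 0 ≤ c ∧ v = c • b := by
  constructor
  · rintro ⟨n, c, x, hc, hx, rfl⟩
    refine ⟨∑ i, c i, Finset.sum_nonneg fun i _ => hc i, ?_⟩
    rw [Finset.sum_smul]
    exact Finset.sum_congr rfl fun i _ => by rw [hx i]
  · rintro ⟨c, hc, rfl⟩
    exact smul_mem_coneOf hc rfl

theorem mem_coneOf_simpleRoots [Fintype S] [DecidableEq S] {v : S → ℝ} :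
    v ∈ coneOf (Set.range (simpleRoot (S := S))) ↔ 0 ≤ v := by
  constructor
  · rintro ⟨n, c, x, hc, hx, rfl⟩
    refine Finset.sum_nonneg fun i _ => smul_nonneg (hc i) ?_
    obtain ⟨s, hs⟩ := hx i
    rw [← hs]
    exact Pi.single_nonneg.2 zero_le_one
  · intro hv
    have : v = ∑ s, v s • simpleRoot s := by
      simpa [simpleRoot, ← Pi.single_smul] using (Finset.univ_sum_single v).symm
    rw [this]
    exact sum_smul_mem_coneOf (fun s => hv s) fun s => ⟨s, rfl⟩

theorem simpleRoot_nonneg [DecidableEq S] (s : S) : 0 ≤ simpleRoot s :=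
  Pi.single_nonneg.2 zero_le_one

theorem simpleRoot_mem_rootSet [DecidableEq S]
    {ρ : W →* ((S → ℝ) ≃ₗ[ℝ] (S → ℝ))} (s : S) : simpleRoot s ∈ rootSet ρ := ⟨1, s, by simp⟩

section

variable {V : Type*} [AddCommGroup V] [Module ℝ V] {ρ : W →* (V ≃ₗ[ℝ] V)}

theorem rep_inv_apply_self (w : W) (v : V) : ρ w⁻¹ (ρ w v) = v := by
  rw [← LinearEquiv.mul_apply, ← map_mul, inv_mul_cancel, map_one, LinearEquiv.coe_one, id]

theorem rep_apply_inv_self (w : W) (v : V) : ρ w (ρ w⁻¹ v) = v := by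
  rw [← LinearEquiv.mul_apply, ← map_mul, mul_inv_cancel, map_one, LinearEquiv.coe_one, id]

theorem rep_mul_apply (w u : W) (v : V) : ρ (w * u) v = ρ w (ρ u v) := by
  rw [map_mul, LinearEquiv.mul_apply]

theorem rep_simple_simple {M : CoxeterMatrix S} (cs : CoxeterSystem M W) (s : S) (v : V) :
    ρ (cs.simple s) (ρ (cs.simple s) v) = v := by
  rw [← rep_mul_apply, cs.simple_mul_simple_self, map_one, LinearEquiv.coe_one, id]

end

theorem map_mem_rootSet [DecidableEq S]
    {ρ : W →* ((S → ℝ) ≃ₗ[ℝ] (S → ℝ))} (w : W) {b : S → ℝ} (hb : b ∈ rootSet ρ) :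
    ρ w b ∈ rootSet ρ := by
  obtain ⟨u, s, rfl⟩ := hb
  exact ⟨w * u, s, (rep_mul_apply w u _).symm⟩

/-! ### The bilinear form -/

theorem bform_comm [Fintype S] {M : CoxeterMatrix S} (v u : S → ℝ) :
    bform M v u = bform M u v := by
  unfold bform
  rw [Finset.sum_comm]
  refine Finset.sum_congr rfl fun s _ => Finset.sum_congr rfl fun t _ => ?_
  rw [M.symmetric t s]
  ring

variable [Fintype S] [DecidableEq S] {M : CoxeterMatrix S}

theorem bform_eq_toBilin' (v u : S → ℝ) :
    bform M v u = Matrix.toBilin'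
      (Matrix.of fun s t => if M s t = 0 then -1 else -Real.cos (Real.pi / (M s t : ℝ))) v u := by
  rw [Matrix.toBilin'_apply]
  exact Finset.sum_congr rfl fun s _ => Finset.sum_congr rfl fun t _ => by
    rw [Matrix.of_apply]; ring

theorem bform_sub_right (v x y : S → ℝ) : bform M v (x - y) = bform M v x - bform M v y := by
  simp only [bform_eq_toBilin', map_sub]

theorem bform_add_right (v x y : S → ℝ) : bform M v (x + y) = bform M v x + bform M v y := by
  simp only [bform_eq_toBilin', map_add]

theorem bform_smul_right (c : ℝ) (v x : S → ℝ) : bform M v (c • x) = c * bform M v x := by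
  simp only [bform_eq_toBilin', map_smul, smul_eq_mul]

theorem bform_sub_left (v x y : S → ℝ) : bform M (x - y) v = bform M x v - bform M y v := by
  simp only [bform_comm _ v, bform_sub_right]

theorem bform_smul_left (c : ℝ) (v x : S → ℝ) : bform M (c • x) v = c * bform M x v := by
  simp only [bform_comm _ v, bform_smul_right]

theorem bform_simpleRoot (s t : S) : bform M (simpleRoot s) (simpleRoot t) =
    if M s t = 0 then -1 else -Real.cos (Real.pi / (M s t : ℝ)) := by
  simp [bform_eq_toBilin', simpleRoot]

theorem bform_simpleRoot_self (s : S) : bform M (simpleRoot s) (simpleRoot s) = 1 := by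
  simp [bform_simpleRoot]

/-! ### The action on roots -/

/-- `ρ` is the geometric representation: each simple reflection acts by the corresponding
`B`-reflection. -/
def IsGeometricRep (cs : CoxeterSystem M W) (ρ : W →* ((S → ℝ) ≃ₗ[ℝ] (S → ℝ))) : Prop :=
  ∀ s, IsReflIn M ρ (cs.simple s) (simpleRoot s)

variable {cs : CoxeterSystem M W} {ρ : W →* ((S → ℝ) ≃ₗ[ℝ] (S → ℝ))}

namespace IsGeometricRep

theorem bform_map (h : IsGeometricRep cs ρ) (w : W) (v u : S → ℝ) :
    bform M (ρ w v) (ρ w u) = bform M v u := by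
  induction w using cs.simple_induction_left with
  | one => simp
  | mul_simple_left w s ih =>
    rw [rep_mul_apply, rep_mul_apply, h s, h s]
    simp only [bform_sub_left, bform_sub_right, bform_smul_left, bform_smul_right, ih,
      bform_simpleRoot_self, bform_comm _ (simpleRoot s)]
    ring

theorem bform_self_of_mem_rootSet (h : IsGeometricRep cs ρ) {b : S → ℝ} (hb : b ∈ rootSet ρ) :
    bform M b b = 1 := by
  obtain ⟨w, s, rfl⟩ := hb
  rw [h.bform_map, bform_simpleRoot_self]

theorem ne_zero_of_mem_rootSet (h : IsGeometricRep cs ρ) {b : S → ℝ} (hb : b ∈ rootSet ρ) :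
    b ≠ 0 := by
  rintro rfl
  have := h.bform_self_of_mem_rootSet hb
  simp [bform_eq_toBilin'] at this

theorem eq_of_eq_smul (h : IsGeometricRep cs ρ) {a b : S → ℝ} (ha : a ∈ rootSet ρ)
    (hb : b ∈ rootSet ρ) {c : ℝ} (hc : 0 ≤ c) (hab : a = c • b) : a = b := by
  have h1 := h.bform_self_of_mem_rootSet ha
  rw [hab, bform_smul_left, bform_smul_right, h.bform_self_of_mem_rootSet hb] at h1
  have : c = 1 := by nlinarith
  rw [hab, this, one_smul]

theorem exists_isReflIn (h : IsGeometricRep cs ρ) {b : S → ℝ} (hb : b ∈ rootSet ρ) :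
    ∃ t, IsReflIn M ρ t b := by
  obtain ⟨w, s, rfl⟩ := hb
  refine ⟨w * cs.simple s * w⁻¹, fun v => ?_⟩
  rw [rep_mul_apply, rep_mul_apply, h s, map_sub, map_smul, rep_apply_inv_self]
  rw [← h.bform_map w (simpleRoot s), rep_apply_inv_self]

end IsGeometricRep

theorem mem_posRoots_iff {b : S → ℝ} : b ∈ posRoots ρ ↔ 0 ≤ b ∧ b ∈ rootSet ρ := by
  rw [posRoots, Set.mem_inter_iff, mem_coneOf_simpleRoots]

/-! ### Length and positivity of roots -/

/-- The coefficients of the roots in a rank two root system. -/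
theorem exists_dihedral_coefficients {s t : S} (hst : s ≠ t) :
    ∃ p : ℕ → ℝ, p 0 = 0 ∧ p 1 = 1 ∧
      (∀ k, p (k + 2) = -(2 * bform M (simpleRoot s) (simpleRoot t)) * p (k + 1) - p k) ∧
      ∀ k, M s t = 0 ∨ k ≤ M s t → 0 ≤ p k := by
  rw [bform_simpleRoot]
  by_cases hm : M s t = 0
  · refine ⟨fun k => k, by simp, by simp, fun k => ?_, fun k _ => Nat.cast_nonneg k⟩
    rw [if_pos hm]
    push_cast
    ring
  · have h1 := M.off_diagonal s t hst
    have h2 : 2 ≤ M s t := by omega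
    have hpos : (0 : ℝ) < M s t := by exact_mod_cast Nat.pos_of_ne_zero hm
    set θ := Real.pi / (M s t : ℝ) with hθ
    have hmθ : M s t * θ = Real.pi := by rw [hθ]; field_simp
    have hθ0 : 0 < θ := div_pos Real.pi_pos hpos
    have hsin : 0 < Real.sin θ := by
      apply Real.sin_pos_of_pos_of_lt_pi hθ0
      rw [← hmθ]
      have : (2 : ℝ) ≤ M s t := by exact_mod_cast h2
      nlinarith
    refine ⟨fun k => Real.sin (k * θ) / Real.sin θ, by simp, by simp [hsin.ne'], fun k => ?_,
      fun k hk => ?_⟩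
    · have e1 : ((k + 2 : ℕ) : ℝ) * θ = ((k + 1 : ℕ) : ℝ) * θ + θ := by push_cast; ring
      have e2 : (k : ℝ) * θ = ((k + 1 : ℕ) : ℝ) * θ - θ := by push_cast; ring
      rw [if_neg hm]
      simp only [e1, e2, Real.sin_add, Real.sin_sub]
      ring
    · have hk' : (k : ℝ) ≤ M s t := by exact_mod_cast hk.resolve_left hm
      apply div_nonneg (Real.sin_nonneg_of_nonneg_of_le_pi (by positivity) _) hsin.le
      rw [← hmθ]
      gcongr

namespace IsGeometricRep

theorem map_alternatingWord_simpleRoot (h : IsGeometricRep cs ρ) {s t : S} {p : ℕ → ℝ}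
    (p_zero : p 0 = 0) (p_one : p 1 = 1)
    (p_rec : ∀ k, p (k + 2) = -(2 * bform M (simpleRoot s) (simpleRoot t)) * p (k + 1) - p k)
    (k : ℕ) :
    ρ (cs.wordProd (CoxeterSystem.alternatingWord s t k)) (simpleRoot s) =
      p (k + 1) • simpleRoot (if Even k then s else t) +
        p k • simpleRoot (if Even k then t else s) := by
  induction k with
  | zero => simp [CoxeterSystem.alternatingWord, p_zero, p_one]
  | succ k ih =>
    rw [CoxeterSystem.alternatingWord_succ', cs.wordProd_cons, rep_mul_apply, ih, h]
    by_cases hk : Even k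
    · simp only [hk, Nat.even_add_one, if_true, not_true, if_false, bform_add_right,
        bform_smul_right, bform_simpleRoot_self, p_rec, bform_comm (simpleRoot t) (simpleRoot s)]
      module
    · simp only [hk, Nat.even_add_one, if_true, not_false_iff, if_false, bform_add_right,
        bform_smul_right, bform_simpleRoot_self, p_rec]
      module

theorem map_simpleRoot_nonneg (h : IsGeometricRep cs ρ) {w : W} {s : S}
    (hs : cs.length w < cs.length (w * cs.simple s)) : 0 ≤ ρ w (simpleRoot s) := by
  induction hn : cs.length w using Nat.strong_induction_on generalizing w s with
  | _ n ih =>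
    subst hn
    by_cases hw : w = 1
    · subst hw
      simpa using simpleRoot_nonneg s
    obtain ⟨t, ht⟩ := cs.exists_rightDescent_of_ne_one hw
    have hst : s ≠ t := by
      rintro rfl
      exact lt_asymm hs ht
    let P : ℕ → Prop := fun k => ∃ v, w = v * cs.wordProd (CoxeterSystem.alternatingWord s t k) ∧
      cs.length v + k = cs.length w
    classical
    have hP1 : P 1 := ⟨w * cs.simple t, by simp [CoxeterSystem.alternatingWord],
      cs.isRightDescent_iff.1 ht⟩
    have hb : 1 ≤ cs.length w := by obtain ⟨v, -, hv⟩ := hP1; omega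
    obtain ⟨v, hwv, hlen⟩ := Nat.findGreatest_spec (P := P) hb hP1
    have hk1 : 1 ≤ Nat.findGreatest P (cs.length w) := Nat.le_findGreatest hb hP1
    have hmax : ¬ P (Nat.findGreatest P (cs.length w) + 1) := fun hP => by
      obtain ⟨v', -, hv'⟩ := id hP
      have := Nat.le_findGreatest (P := P) (n := cs.length w) (by omega) hP
      omega
    generalize Nat.findGreatest P (cs.length w) = k at hwv hlen hk1 hmax
    have hnext : cs.length v < cs.length (v * cs.simple (if Even k then t else s)) := by
      rcases cs.length_mul_simple v (if Even k then t else s) with hl | hl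
      · omega
      · refine absurd ⟨v * cs.simple (if Even k then t else s), ?_, by omega⟩ hmax
        rw [CoxeterSystem.alternatingWord_succ', cs.wordProd_cons, ← mul_assoc,
          cs.simple_mul_simple_cancel_right, hwv]
    have hprev : cs.length v < cs.length (v * cs.simple (if Even k then s else t)) := by
      obtain ⟨n, rfl⟩ := Nat.exists_eq_add_of_le' hk1
      have hl := cs.length_mul_le (v * cs.simple (if Even n then t else s))
        (cs.wordProd (CoxeterSystem.alternatingWord s t n))
      have hl' := cs.length_wordProd_le (CoxeterSystem.alternatingWord s t n)
      rw [mul_assoc, ← cs.wordProd_cons, ← CoxeterSystem.alternatingWord_succ', ← hwv] at hl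
      rw [CoxeterSystem.length_alternatingWord] at hl'
      simp only [Nat.even_add_one, ite_not]
      omega
    have hkm : M s t = 0 ∨ k + 1 ≤ M s t := by
      by_contra! hcon
      have hnr := cs.not_isReduced_alternatingWord t s (m := k + 1)
        (by rw [M.symmetric]; exact hcon.1) (by rw [M.symmetric]; exact hcon.2)
      have hle := cs.length_wordProd_le (CoxeterSystem.alternatingWord t s (k + 1))
      rw [CoxeterSystem.IsReduced] at hnr
      rw [CoxeterSystem.length_alternatingWord] at hnr hle
      have hlt := cs.length_mul_le v (cs.wordProd (CoxeterSystem.alternatingWord t s (k + 1)))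
      rw [CoxeterSystem.alternatingWord_succ, cs.wordProd_concat] at hnr hle hlt
      rw [← mul_assoc, ← hwv] at hlt
      omega
    obtain ⟨p, p_zero, p_one, p_rec, p_nonneg⟩ := exists_dihedral_coefficients (M := M) hst
    rw [hwv, rep_mul_apply, h.map_alternatingWord_simpleRoot p_zero p_one p_rec, map_add,
      map_smul, map_smul]
    exact add_nonneg
      (smul_nonneg (p_nonneg _ hkm) (ih _ (by omega) hprev rfl))
      (smul_nonneg (p_nonneg _ (hkm.imp_right (by omega))) (ih _ (by omega) hnext rfl))

theorem nonneg_or_nonpos (h : IsGeometricRep cs ρ) {b : S → ℝ} (hb : b ∈ rootSet ρ) :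
    0 ≤ b ∨ b ≤ 0 := by
  obtain ⟨w, s, rfl⟩ := hb
  rcases cs.length_mul_simple w s with hl | hl
  · exact Or.inl (h.map_simpleRoot_nonneg (by omega))
  · right
    have := h.map_simpleRoot_nonneg (w := w * cs.simple s) (s := s) (by
      rw [cs.simple_mul_simple_cancel_right]; omega)
    rw [rep_mul_apply, h s, bform_simpleRoot_self, map_sub, map_smul] at this
    have e : ρ w (simpleRoot s) - (2 * 1 : ℝ) • ρ w (simpleRoot s) = - ρ w (simpleRoot s) := by
      module
    rwa [e, neg_nonneg] at this

end IsGeometricRep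

/-! ### Inversion sets -/

namespace IsGeometricRep

theorem neg_mem_rootSet (h : IsGeometricRep cs ρ) {b : S → ℝ} (hb : b ∈ rootSet ρ) :
    -b ∈ rootSet ρ := by
  obtain ⟨w, s, rfl⟩ := hb
  refine ⟨w * cs.simple s, s, ?_⟩
  rw [rep_mul_apply, h s, bform_simpleRoot_self, map_sub, map_smul]
  module

theorem mem_invSet_iff (h : IsGeometricRep cs ρ) {w : W} {b : S → ℝ} :
    b ∈ invSet ρ w ↔ b ∈ rootSet ρ ∧ 0 ≤ b ∧ ρ w⁻¹ b ≤ 0 := by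
  rw [invSet, Set.mem_ofPred_eq, negRoots, Set.mem_ofPred_eq, mem_posRoots_iff, mem_posRoots_iff,
    neg_nonneg]
  constructor
  · rintro ⟨⟨h0, hr⟩, hn, -⟩
    exact ⟨hr, h0, hn⟩
  · rintro ⟨hr, h0, hn⟩
    exact ⟨⟨h0, hr⟩, hn, h.neg_mem_rootSet (map_mem_rootSet _ hr)⟩

theorem not_nonneg_and_nonpos (h : IsGeometricRep cs ρ) {b : S → ℝ} (hb : b ∈ rootSet ρ)
    (h0 : 0 ≤ b) (h1 : b ≤ 0) : False :=
  h.ne_zero_of_mem_rootSet hb (le_antisymm h1 h0)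

theorem simple_map_nonneg (h : IsGeometricRep cs ρ) {b : S → ℝ} {s : S} (hb : b ∈ rootSet ρ)
    (h0 : 0 ≤ b) (hbs : b ≠ simpleRoot s) : 0 ≤ ρ (cs.simple s) b := by
  refine (h.nonneg_or_nonpos (map_mem_rootSet _ hb)).resolve_right fun hneg => hbs ?_
  refine h.eq_of_eq_smul hb (simpleRoot_mem_rootSet s) (h0 s) ?_
  ext t
  by_cases hts : t = s
  · subst hts
    simp [simpleRoot]
  · have h1 := hneg t
    rw [h s] at h1
    simp only [simpleRoot, Pi.sub_apply, Pi.smul_apply, Pi.single_eq_of_ne hts, smul_zero, sub_zero,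
      Pi.zero_apply] at h1 ⊢
    exact le_antisymm h1 (h0 t)

theorem simple_map_simpleRoot (h : IsGeometricRep cs ρ) (s : S) :
    ρ (cs.simple s) (simpleRoot s) = -simpleRoot s := by
  rw [h s, bform_simpleRoot_self]
  module

theorem map_inv_simpleRoot_nonneg (h : IsGeometricRep cs ρ) {w : W} {s : S}
    (hs : cs.length w < cs.length (cs.simple s * w)) : 0 ≤ ρ w⁻¹ (simpleRoot s) := by
  apply h.map_simpleRoot_nonneg
  rwa [cs.length_inv, ← cs.length_inv (w⁻¹ * _), mul_inv_rev, inv_inv, cs.inv_simple]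

theorem invSet_simple_mul (h : IsGeometricRep cs ρ) {w : W} {s : S}
    (hs : cs.length w < cs.length (cs.simple s * w)) :
    invSet ρ (cs.simple s * w) = insert (simpleRoot s) (ρ (cs.simple s) '' invSet ρ w) := by
  have hpos := h.map_inv_simpleRoot_nonneg hs
  ext b
  simp only [Set.mem_insert_iff, Set.mem_image, h.mem_invSet_iff, mul_inv_rev, cs.inv_simple,
    rep_mul_apply]
  constructor
  · rintro ⟨hr, h0, hn⟩
    refine or_iff_not_imp_left.2 fun hbs => ⟨ρ (cs.simple s) b, ?_, rep_simple_simple cs s b⟩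
    exact ⟨map_mem_rootSet _ hr, h.simple_map_nonneg hr h0 hbs, hn⟩
  · rintro (rfl | ⟨c, ⟨hr, h0, hn⟩, rfl⟩)
    · refine ⟨simpleRoot_mem_rootSet s, simpleRoot_nonneg s, ?_⟩
      rwa [h.simple_map_simpleRoot, map_neg, neg_nonpos]
    · refine ⟨map_mem_rootSet _ hr, h.simple_map_nonneg hr h0 ?_, ?_⟩
      · rintro rfl
        exact h.not_nonneg_and_nonpos (map_mem_rootSet _ hr) hpos hn
      · rwa [rep_simple_simple]

theorem finite_and_ncard_invSet (h : IsGeometricRep cs ρ) (w : W) :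
    (invSet ρ w).Finite ∧ (invSet ρ w).ncard = cs.length w := by
  induction hn : cs.length w using Nat.strong_induction_on generalizing w with
  | _ n ih =>
    subst hn
    by_cases hw : w = 1
    · have he : invSet ρ w = ∅ := by
        refine Set.eq_empty_of_forall_notMem fun b hb => ?_
        obtain ⟨hr, h0, h1⟩ := h.mem_invSet_iff.1 hb
        rw [hw, inv_one, map_one, LinearEquiv.coe_one, id] at h1
        exact h.not_nonneg_and_nonpos hr h0 h1
      rw [he, hw]
      simp
    obtain ⟨s, hs⟩ := cs.exists_leftDescent_of_ne_one hw
    obtain ⟨hfin, hcard⟩ := ih _ hs _ rfl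
    have hsw : cs.simple s * (cs.simple s * w) = w := cs.simple_mul_simple_cancel_left s
    have heq := h.invSet_simple_mul (w := cs.simple s * w) (s := s) (by rwa [hsw])
    rw [hsw] at heq
    have hnot : simpleRoot s ∉ ρ (cs.simple s) '' invSet ρ (cs.simple s * w) := by
      rintro ⟨c, hc, hcs⟩
      have h0 := (h.mem_invSet_iff.1 hc).2.1
      rw [← rep_simple_simple cs (ρ := ρ) s c, hcs, h.simple_map_simpleRoot, neg_nonneg] at h0
      exact h.not_nonneg_and_nonpos (simpleRoot_mem_rootSet s) (simpleRoot_nonneg s) h0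
    rw [heq]
    refine ⟨(hfin.image _).insert _, ?_⟩
    rw [Set.ncard_insert_of_notMem hnot (hfin.image _),
      Set.ncard_image_of_injective _ (ρ (cs.simple s)).injective, hcard]
    exact cs.isLeftDescent_iff.1 hs

theorem finite_invSet (h : IsGeometricRep cs ρ) (w : W) : (invSet ρ w).Finite :=
  (h.finite_and_ncard_invSet w).1

theorem ncard_invSet (h : IsGeometricRep cs ρ) (w : W) : (invSet ρ w).ncard = cs.length w :=
  (h.finite_and_ncard_invSet w).2

/-! ### Reflections and the change of inversion sets -/

section Reflection

variable {a : S → ℝ} {t w : W}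

theorem refl_map_self (h : IsGeometricRep cs ρ) (ht : IsReflIn M ρ t a) (ha : a ∈ rootSet ρ) :
    ρ t a = -a := by
  rw [ht, h.bform_self_of_mem_rootSet ha]
  module

theorem refl_map_map (h : IsGeometricRep cs ρ) (ht : IsReflIn M ρ t a) (ha : a ∈ rootSet ρ)
    (v : S → ℝ) : ρ t (ρ t v) = v := by
  rw [ht v, map_sub, map_smul, h.refl_map_self ht ha, ht v]
  module

theorem refl_mul_inv_apply (h : IsGeometricRep cs ρ) (ht : IsReflIn M ρ t a) (ha : a ∈ rootSet ρ)
    (v : S → ℝ) : ρ (t * w)⁻¹ v = ρ w⁻¹ (ρ t v) := by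
  rw [mul_inv_rev, rep_mul_apply]
  congr 1
  rw [← rep_inv_apply_self (ρ := ρ) t (ρ t v), h.refl_map_map ht ha]

theorem bform_pos_of_refl_nonpos (h : IsGeometricRep cs ρ) (ht : IsReflIn M ρ t a) (ha : 0 ≤ a)
    {b : S → ℝ} (hb : b ∈ rootSet ρ) (hb0 : 0 ≤ b) (hbn : ρ t b ≤ 0) : 0 < bform M a b := by
  by_contra! hB
  refine h.not_nonneg_and_nonpos hb hb0 (le_trans ?_ hbn)
  rw [ht, le_sub_self_iff]
  exact smul_nonpos_of_nonpos_of_nonneg (by linarith) ha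

open Classical in
/-- The map sending a root `b` to `ρ t b` if this is positive, and to `b` otherwise. When `t` is
the reflection in `a ∈ N(w)`, it maps `N(t w)` injectively into `N(w) \ {a}`. -/
noncomputable def reflFold (ρ : W →* ((S → ℝ) ≃ₗ[ℝ] (S → ℝ))) (t : W) (b : S → ℝ) : S → ℝ :=
  if 0 ≤ ρ t b then ρ t b else b

theorem reflFold_image_subset (h : IsGeometricRep cs ρ) (ht : IsReflIn M ρ t a)
    (ha : a ∈ invSet ρ w) : reflFold ρ t '' invSet ρ (t * w) ⊆ invSet ρ w \ {a} := by
  obtain ⟨har, ha0, han⟩ := h.mem_invSet_iff.1 ha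
  rintro _ ⟨b, hb, rfl⟩
  obtain ⟨hr, h0, hn⟩ := h.mem_invSet_iff.1 hb
  rw [h.refl_mul_inv_apply ht har] at hn
  rw [Set.mem_sdiff, Set.mem_singleton_iff, reflFold]
  split_ifs with hpos
  · refine ⟨h.mem_invSet_iff.2 ⟨map_mem_rootSet _ hr, hpos, hn⟩, fun he => ?_⟩
    rw [← h.refl_map_map ht har b, he, h.refl_map_self ht har, neg_nonneg] at h0
    exact h.not_nonneg_and_nonpos har ha0 h0
  · have hneg := (h.nonneg_or_nonpos (map_mem_rootSet t hr)).resolve_left hpos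
    have hB := h.bform_pos_of_refl_nonpos ht ha0 hr h0 hneg
    refine ⟨h.mem_invSet_iff.2 ⟨hr, h0, ?_⟩, ?_⟩
    · have e : b = ρ t b + (2 * bform M a b) • a := by rw [ht]; module
      rw [e, map_add, map_smul]
      exact add_nonpos hn (smul_nonpos_of_nonneg_of_nonpos (by positivity) han)
    · rintro rfl
      rw [h.refl_map_self ht har, map_neg, neg_nonpos] at hn
      exact h.not_nonneg_and_nonpos (map_mem_rootSet _ har) hn han

theorem reflFold_injOn (h : IsGeometricRep cs ρ) (ht : IsReflIn M ρ t a) (ha : a ∈ rootSet ρ) :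
    Set.InjOn (reflFold ρ t) (invSet ρ (t * w)) := by
  intro b hb c hc hbc
  have hb0 := (h.mem_invSet_iff.1 hb).2.1
  have hc0 := (h.mem_invSet_iff.1 hc).2.1
  rw [reflFold, reflFold] at hbc
  split_ifs at hbc with h1 h2 h2
  · exact (ρ t).injective hbc
  · rw [← hbc, h.refl_map_map ht ha] at h2
    exact absurd hb0 h2
  · rw [hbc, h.refl_map_map ht ha] at h1
    exact absurd hc0 h1
  · exact hbc

theorem ncard_reflFold_image (h : IsGeometricRep cs ρ) (ht : IsReflIn M ρ t a)
    (ha : a ∈ rootSet ρ) : (reflFold ρ t '' invSet ρ (t * w)).ncard = cs.length (t * w) := by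
  rw [(h.reflFold_injOn ht ha).ncard_image, h.ncard_invSet]

theorem ncard_invSet_sdiff_add_one (h : IsGeometricRep cs ρ) (ha : a ∈ invSet ρ w) :
    (invSet ρ w \ {a}).ncard + 1 = cs.length w := by
  rw [Set.ncard_sdiff_singleton_add_one ha (h.finite_invSet w), h.ncard_invSet]

theorem length_refl_mul_lt (h : IsGeometricRep cs ρ) (ht : IsReflIn M ρ t a)
    (ha : a ∈ invSet ρ w) : cs.length (t * w) < cs.length w := by
  have h1 := Set.ncard_le_ncard (h.reflFold_image_subset ht ha) (h.finite_invSet w).sdiff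
  rw [h.ncard_reflFold_image ht (h.mem_invSet_iff.1 ha).1] at h1
  have h2 := h.ncard_invSet_sdiff_add_one ha
  omega

theorem length_refl_mul_add_one_iff_image (h : IsGeometricRep cs ρ) (ht : IsReflIn M ρ t a)
    (ha : a ∈ invSet ρ w) : cs.length (t * w) + 1 = cs.length w ↔
      reflFold ρ t '' invSet ρ (t * w) = invSet ρ w \ {a} := by
  rw [← h.ncard_invSet_sdiff_add_one ha,
    ← h.ncard_reflFold_image ht (h.mem_invSet_iff.1 ha).1, add_left_inj]
  refine ⟨fun he => ?_, fun he => by rw [he]⟩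
  exact Set.eq_of_subset_of_ncard_le (h.reflFold_image_subset ht ha) he.ge
    (h.finite_invSet w).sdiff

/-- If `ℓ(s_a w) = ℓ(w) - 1`, each inversion of `w` other than `a` is congruent modulo `a` to an
inversion of `s_a w`. -/
theorem mem_invSet_refl_mul_of_length (h : IsGeometricRep cs ρ) (ht : IsReflIn M ρ t a)
    (ha : a ∈ invSet ρ w) (hl : cs.length (t * w) + 1 = cs.length w) {b : S → ℝ}
    (hb : b ∈ invSet ρ w) (hba : b ≠ a) :
    b ∈ invSet ρ (t * w) ∨ ρ t b ∈ invSet ρ (t * w) := by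
  have hb' : b ∈ invSet ρ w \ {a} := ⟨hb, hba⟩
  rw [← (h.length_refl_mul_add_one_iff_image ht ha).1 hl] at hb'
  obtain ⟨c, hc, rfl⟩ := hb'
  rw [reflFold]
  split_ifs
  · rw [h.refl_map_map ht (h.mem_invSet_iff.1 ha).1]
    exact Or.inr hc
  · exact Or.inl hc

/-- If no inversion `b ≠ a` of `w` has its mirror image `-s_a(b)` among the inversions of `w`,
then `ℓ(s_a w) = ℓ(w) - 1`. -/
theorem length_refl_mul_add_one (h : IsGeometricRep cs ρ) (ht : IsReflIn M ρ t a)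
    (ha : a ∈ invSet ρ w) (hmirror : ∀ b ∈ invSet ρ w, -ρ t b ∈ invSet ρ w → b = a) :
    cs.length (t * w) + 1 = cs.length w := by
  rw [h.length_refl_mul_add_one_iff_image ht ha]
  refine (h.reflFold_image_subset ht ha).antisymm ?_
  have har := (h.mem_invSet_iff.1 ha).1
  rintro b ⟨hb, hba⟩
  obtain ⟨hr, h0, hn⟩ := h.mem_invSet_iff.1 hb
  have hr' := map_mem_rootSet (ρ := ρ) t hr
  by_cases hpos : 0 ≤ ρ t b
  · refine ⟨ρ t b, h.mem_invSet_iff.2 ⟨hr', hpos, ?_⟩, ?_⟩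
    · rwa [h.refl_mul_inv_apply ht har, h.refl_map_map ht har]
    · rw [reflFold, h.refl_map_map ht har, if_pos h0]
  · refine ⟨b, h.mem_invSet_iff.2 ⟨hr, h0, ?_⟩, by rw [reflFold, if_neg hpos]⟩
    rw [h.refl_mul_inv_apply ht har]
    refine (h.nonneg_or_nonpos (map_mem_rootSet _ hr')).resolve_left fun hge => hba ?_
    refine hmirror b hb (h.mem_invSet_iff.2 ⟨h.neg_mem_rootSet hr', ?_, ?_⟩)
    · exact neg_nonneg.2 ((h.nonneg_or_nonpos hr').resolve_left hpos)
    · rwa [map_neg, neg_nonpos]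

theorem mem_invSet_of_length (h : IsGeometricRep cs ρ) (hfaith : Function.Injective ρ)
    (ht : IsReflIn M ρ t a) (ha : a ∈ posRoots ρ) (hl : cs.length (t * w) < cs.length w) :
    a ∈ invSet ρ w := by
  obtain ⟨ha0, har⟩ := mem_posRoots_iff.1 ha
  refine h.mem_invSet_iff.2 ⟨har, ha0, ?_⟩
  refine (h.nonneg_or_nonpos (map_mem_rootSet _ har)).resolve_left fun hpos => ?_
  have hmem : a ∈ invSet ρ (t * w) := h.mem_invSet_iff.2 ⟨har, ha0, by
    rwa [h.refl_mul_inv_apply ht har, h.refl_map_self ht har, map_neg, neg_nonpos]⟩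
  have htt : t * t = 1 := hfaith <| LinearEquiv.ext fun v => by
    rw [rep_mul_apply, h.refl_map_map ht har, map_one, LinearEquiv.coe_one, id]
  have := h.length_refl_mul_lt ht hmem
  rw [← mul_assoc, htt, one_mul] at this
  omega

/-- If `ℓ(s_a w) = ℓ(w) - 1`, each element of `cone(N(w))` is congruent modulo `a` to an element
that is nonnegative and made nonpositive by `(s_a w)⁻¹`. -/
theorem exists_eq_add_smul_of_mem_coneOf (h : IsGeometricRep cs ρ) (ht : IsReflIn M ρ t a)
    (ha : a ∈ invSet ρ w) (hl : cs.length (t * w) + 1 = cs.length w) {x : S → ℝ}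
    (hx : x ∈ coneOf (invSet ρ w)) :
    ∃ (y : S → ℝ) (r : ℝ), x = y + r • a ∧ 0 ≤ y ∧ ρ (t * w)⁻¹ y ≤ 0 ∧ (y = 0 → 0 ≤ r) := by
  obtain ⟨n, c, b, hc, hb, rfl⟩ := hx
  refine Finset.sum_induction _ (fun x => ∃ (y : S → ℝ) (r : ℝ), x = y + r • a ∧ 0 ≤ y ∧
    ρ (t * w)⁻¹ y ≤ 0 ∧ (y = 0 → 0 ≤ r)) ?_ ⟨0, 0, by simp⟩ ?_
  · rintro _ _ ⟨y, r, rfl, hy, hy', hr⟩ ⟨z, q, rfl, hz, hz', hq⟩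
    refine ⟨y + z, r + q, by module, add_nonneg hy hz, ?_, fun h0 => ?_⟩
    · rw [map_add]
      exact add_nonpos hy' hz'
    · obtain ⟨h1, h2⟩ := (add_eq_zero_iff_of_nonneg hy hz).1 h0
      exact add_nonneg (hr h1) (hq h2)
  · intro i _
    rcases (hc i).eq_or_lt with h0 | hpos
    · exact ⟨0, 0, by simp [← h0]⟩
    by_cases hba : b i = a
    · exact ⟨0, c i, by simp [hba], le_rfl, by simp, fun _ => hpos.le⟩
    have key : ∀ d ∈ invSet ρ (t * w), ∀ r : ℝ, c i • b i = c i • d + r • a →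
        ∃ (y : S → ℝ) (r : ℝ), c i • b i = y + r • a ∧ 0 ≤ y ∧ ρ (t * w)⁻¹ y ≤ 0 ∧
          (y = 0 → 0 ≤ r) := by
      intro d hd r hr
      obtain ⟨hdr, hd0, hdn⟩ := h.mem_invSet_iff.1 hd
      refine ⟨c i • d, r, hr, smul_nonneg hpos.le hd0, ?_, fun h0 => ?_⟩
      · rw [map_smul]
        exact smul_nonpos_of_nonneg_of_nonpos hpos.le hdn
      · exact absurd h0 (smul_ne_zero hpos.ne' (h.ne_zero_of_mem_rootSet hdr))
    rcases h.mem_invSet_refl_mul_of_length ht ha hl (hb i) hba with hd | hd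
    · exact key _ hd 0 (by module)
    · exact key _ hd (c i * (2 * bform M a (b i))) (by rw [ht]; module)

theorem mem_coneOf_singleton_of_add_mem (h : IsGeometricRep cs ρ) (ht : IsReflIn M ρ t a)
    (ha : a ∈ invSet ρ w) (hl : cs.length (t * w) + 1 = cs.length w) {x y : S → ℝ}
    (hx : x ∈ coneOf (invSet ρ w)) (hy : y ∈ coneOf (invSet ρ w)) (hxy : x + y ∈ coneOf {a}) :
    x ∈ coneOf {a} ∧ y ∈ coneOf {a} := by
  obtain ⟨har, ha0, han⟩ := h.mem_invSet_iff.1 ha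
  obtain ⟨x', r, rfl, hx0, hxn, hr⟩ := h.exists_eq_add_smul_of_mem_coneOf ht ha hl hx
  obtain ⟨y', q, rfl, hy0, hyn, hq⟩ := h.exists_eq_add_smul_of_mem_coneOf ht ha hl hy
  obtain ⟨c, -, hc⟩ := mem_coneOf_singleton.1 hxy
  have hsum : x' + y' = (c - r - q) • a := by
    rw [sub_smul, sub_smul, ← hc]
    module
  have hzero : x' + y' = 0 := by
    rcases le_total 0 (c - r - q) with hm | hm
    · have h1 : ρ (t * w)⁻¹ (x' + y') ≤ 0 := by
        rw [map_add]
        exact add_nonpos hxn hyn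
      have h2 : 0 ≤ ρ (t * w)⁻¹ (x' + y') := by
        rw [hsum, map_smul, h.refl_mul_inv_apply ht har, h.refl_map_self ht har, map_neg]
        exact smul_nonneg hm (neg_nonneg.2 han)
      exact (ρ (t * w)⁻¹).map_eq_zero_iff.1 (le_antisymm h1 h2)
    · refine le_antisymm ?_ (add_nonneg hx0 hy0)
      rw [hsum]
      exact smul_nonpos_of_nonpos_of_nonneg hm ha0
  obtain ⟨hx1, hy1⟩ := (add_eq_zero_iff_of_nonneg hx0 hy0).1 hzero
  exact ⟨mem_coneOf_singleton.2 ⟨r, hr hx1, by rw [hx1, zero_add]⟩,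
    mem_coneOf_singleton.2 ⟨q, hq hy1, by rw [hy1, zero_add]⟩⟩

end Reflection

/-- A root spanning an extreme ray of a cone generated by roots is one of the generators. -/
theorem mem_of_extreme (h : IsGeometricRep cs ρ) {X : Set (S → ℝ)} (hX : X ⊆ rootSet ρ)
    {a : S → ℝ} (ha : a ∈ rootSet ρ) (haX : a ∈ coneOf X)
    (hext : ∀ x ∈ coneOf X, ∀ y ∈ coneOf X, x + y ∈ coneOf {a} → x ∈ coneOf {a}) : a ∈ X := by
  obtain ⟨n, c, b, hc, hb, hsum⟩ := haX
  obtain ⟨i, -, hi⟩ := Finset.exists_ne_zero_of_sum_ne_zero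
    (hsum ▸ h.ne_zero_of_mem_rootSet ha)
  have hci : c i ≠ 0 := fun h0 => hi (by rw [h0, zero_smul])
  have hsplit : a = c i • b i + ∑ j, (if j = i then 0 else c j) • b j := by
    rw [hsum, ← Finset.add_sum_erase _ _ (Finset.mem_univ i),
      ← Finset.add_sum_erase _ (fun j => (if j = i then 0 else c j) • b j) (Finset.mem_univ i),
      if_pos rfl, zero_smul, zero_add]
    congr 1
    exact Finset.sum_congr rfl fun j hj => by rw [if_neg (Finset.ne_of_mem_erase hj)]
  have hmem := hext _ (smul_mem_coneOf (hc i) (hb i)) _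
    (sum_smul_mem_coneOf (c := fun j => if j = i then 0 else c j)
      (fun j => by split_ifs; exacts [le_rfl, hc j]) hb)
    (hsplit ▸ subset_coneOf _ rfl)
  obtain ⟨d, hd, hbd⟩ := mem_coneOf_singleton.1 hmem
  have hba : b i = a := by
    refine h.eq_of_eq_smul (hX (hb i)) ha (c := (c i)⁻¹ * d)
      (mul_nonneg (inv_nonneg.2 (hc i)) hd) ?_
    rw [mul_smul, ← hbd, inv_smul_smul₀ hci]
  exact hba ▸ hb i

end IsGeometricRep

end GeometricRepresentation

/-- **Lemma 4.4.** For every `w ∈ W`, `N¹(w)` is exactly the set of positive roots `α`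
such that `cone({α})` is an extreme ray of the polyhedral cone `cone(N(w))`, where a ray
`R = cone({α}) ⊆ C` is extreme in `C` when `x, y ∈ C` and `x + y ∈ R` imply
`x, y ∈ R`. -/
theorem nOne_eq_extremeRays {S : Type*} [Fintype S] [DecidableEq S]
    (Mmat : CoxeterMatrix S) {W : Type*} [Group W] (cs : CoxeterSystem Mmat W)
    (ρ : W →* ((S → ℝ) ≃ₗ[ℝ] (S → ℝ)))
    (hfaith : Function.Injective ρ)
    (hρ : ∀ (s : S) (v : S → ℝ),
      ρ (cs.simple s) v = v - (2 * bform Mmat (simpleRoot s) v) • simpleRoot s)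
    (w : W) :
    nOne cs ρ w =
      {b : S → ℝ | b ∈ posRoots ρ ∧ coneOf {b} ⊆ coneOf (invSet ρ w) ∧
        ∀ x ∈ coneOf (invSet ρ w), ∀ y ∈ coneOf (invSet ρ w),
          x + y ∈ coneOf {b} → x ∈ coneOf {b} ∧ y ∈ coneOf {b}} := by
  have h : IsGeometricRep cs ρ := hρ
  ext a
  constructor
  · rintro ⟨hpos, t, ht, hl⟩
    have ha : a ∈ invSet ρ w := h.mem_invSet_of_length hfaith ht hpos (by omega)
    refine ⟨hpos, fun v hv => ?_, fun x hx y hy hxy =>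
      h.mem_coneOf_singleton_of_add_mem ht ha hl hx hy hxy⟩
    obtain ⟨c, hc, rfl⟩ := mem_coneOf_singleton.1 hv
    exact smul_mem_coneOf hc ha
  · rintro ⟨hpos, hsub, hext⟩
    obtain ⟨ha0, har⟩ := mem_posRoots_iff.1 hpos
    have ha : a ∈ invSet ρ w := h.mem_of_extreme (fun b hb => (h.mem_invSet_iff.1 hb).1) har
      (hsub (subset_coneOf _ rfl)) fun x hx y hy hxy => (hext x hx y hy hxy).1
    obtain ⟨t, ht⟩ := h.exists_isReflIn har
    refine ⟨hpos, t, ht, h.length_refl_mul_add_one ht ha fun b hb hb' => ?_⟩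
    obtain ⟨hbr, hb0, -⟩ := h.mem_invSet_iff.1 hb
    have hneg := neg_nonneg.1 (h.mem_invSet_iff.1 hb').2.1
    have hB := h.bform_pos_of_refl_nonpos ht ha0 hbr hb0 hneg
    have hsum : b + -ρ t b = (2 * bform Mmat a b) • a := by
      rw [ht]
      module
    have hmem := (hext b (subset_coneOf _ hb) _ (subset_coneOf _ hb')
      (mem_coneOf_singleton.2 ⟨_, by positivity, hsum⟩)).1
    obtain ⟨d, hd, hbd⟩ := mem_coneOf_singleton.1 hmem
    exact h.eq_of_eq_smul hbr har hd hbd
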